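/- Let c, d, d̂ ∈ ℝⁿ, and let θ ≥ 0, δ ≥ 0, δ_max ≥ δ be real numbers such that ‖d‖ ≤ θ and ‖d̂ − d‖ ≤ δ. Let r, β ∈ ℝ. If r − ‖c‖·(θ + 2δ_max) ≥ −β (the worst-case robust condition), then r + ⟨c, d̂⟩ − ‖c‖·δ ≥ −β (the DOB-based condition), and also r + ⟨c, d⟩ ≥ −β (the true condition). In particular, along the way ⟨c, d̂⟩ ≥ −‖c‖·(θ + δ) and ⟨c, d̂⟩ − ‖c‖·δ ≥ −‖c‖·(θ + 2δ). -/

import Mathlib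

/-- The worst-case robust condition `r − ‖c‖·(θ + 2δ_max) ≥ −β` implies both
the DOB-based condition `r + ⟨c, d̂⟩ − ‖c‖·δ ≥ −β` and the true condition
`r + ⟨c, d⟩ ≥ −β`; along the way, `⟨c, d̂⟩ ≥ −‖c‖·(θ + δ)` and
`⟨c, d̂⟩ − ‖c‖·δ ≥ −‖c‖·(θ + 2δ)`. -/
theorem stmt_10 {n : ℕ} (c d dhat : EuclideanSpace ℝ (Fin n))
    (θ δ δmax : ℝ) (hθ : 0 ≤ θ) (hδ : 0 ≤ δ) (hδmax : δ ≤ δmax)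
    (hdbound : ‖d‖ ≤ θ) (herr : ‖dhat - d‖ ≤ δ) (r β : ℝ)
    (hworst : r - ‖c‖ * (θ + 2 * δmax) ≥ -β) :
    (r + (inner ℝ c dhat : ℝ) - ‖c‖ * δ ≥ -β) ∧
    (r + (inner ℝ c d : ℝ) ≥ -β) ∧
    ((inner ℝ c dhat : ℝ) ≥ -(‖c‖ * (θ + δ))) ∧
    ((inner ℝ c dhat : ℝ) - ‖c‖ * δ ≥ -(‖c‖ * (θ + 2 * δ))) := by
  have h1 := (abs_le.mp (abs_real_inner_le_norm c d)).1
  have h2 := (abs_le.mp (abs_real_inner_le_norm c (dhat - d))).1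
  rw [inner_sub_right] at h2
  have h3 := mul_le_mul_of_nonneg_left hdbound (norm_nonneg c)
  have h4 := mul_le_mul_of_nonneg_left herr (norm_nonneg c)
  have h5 := mul_le_mul_of_nonneg_left hδmax (norm_nonneg c)
  have h6 := mul_nonneg (norm_nonneg c) hδ
  refine ⟨?_, ?_, ?_, ?_⟩ <;> linarith
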